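/- The Łukasiewicz axiom system L1, L2, L3, with condensed detachment as the sole rule of inference, admits strong double-negation elimination. -/

import Mathlib

/-- Propositional formulas built from countably many variables by implication `i`
and negation `n`. -/
inductive Fm : Type
  | var : ℕ → Fm
  | i : Fm → Fm → Fm
  | n : Fm → Fm
  deriving DecidableEq

namespace Fm

/-- Homomorphic extension of a substitution (of formulas for variables). -/
def subst (σ : ℕ → Fm) : Fm → Fm
  | var k => σ k
  | i a b => i (subst σ a) (subst σ b)
  | n a => n (subst σ a)

/-- The (finite) set of variables occurring in a formula. -/
def vars : Fm → Finset ℕ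
  | var k => {k}
  | i a b => vars a ∪ vars b
  | n a => vars a

/-- `Sub s t` : `s` is a (not necessarily proper) subformula of `t`. -/
inductive Sub : Fm → Fm → Prop
  | refl (t : Fm) : Sub t t
  | il {s a b : Fm} : Sub s a → Sub s (i a b)
  | ir {s a b : Fm} : Sub s b → Sub s (i a b)
  | neg {s a : Fm} : Sub s a → Sub s (n a)

end Fm

/-- The renaming substitution induced by a permutation of the variables. -/
def renameSubst (p : Equiv.Perm ℕ) : ℕ → Fm := fun k => Fm.var (p k)

/-- `AlphVar A B` : `B` is an alphabetic variant of `A`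
(obtained from `A` by an injective renaming of variables). -/
def AlphVar (A B : Fm) : Prop := ∃ p : Equiv.Perm ℕ, B = A.subst (renameSubst p)

/-- `σ` unifies `A` and `C`. -/
def Unifies (σ : ℕ → Fm) (A C : Fm) : Prop := A.subst σ = C.subst σ

/-- `σ` is a most general unifier of `A` and `C`. -/
def IsMGU (σ : ℕ → Fm) (A C : Fm) : Prop :=
  Unifies σ A C ∧ ∀ τ : ℕ → Fm, Unifies τ A C → ∃ ρ : ℕ → Fm, ∀ k, τ k = (σ k).subst ρ

/-- Condensed detachment: from the major premiss `maj = i(A,B)` and minor premiss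
`minor` (renamed to `C`, sharing no variables with the major premiss), if `σ` is a
most general unifier of `A` and `C`, conclude `Bσ` (up to renaming of variables). -/
def CD (maj minor concl : Fm) : Prop :=
  ∃ (A B C : Fm) (σ : ℕ → Fm),
    maj = Fm.i A B ∧ AlphVar minor C ∧ Disjoint (Fm.i A B).vars C.vars ∧
    IsMGU σ A C ∧ AlphVar (B.subst σ) concl

/-- A formula contains a double negation if it has a subformula of the form `n(n(t))`. -/
def ContainsDN (A : Fm) : Prop := ∃ t : Fm, Fm.Sub (Fm.n (Fm.n t)) A

/-- Existence of a condensed-detachment proof from axiom set `L` in which every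
*deduced* (non-axiom) step satisfies the predicate `allowed`.  A step is an
alphabetic variant of an axiom of `L` or follows from two earlier steps by
condensed detachment. -/
inductive CDProof (L : Set Fm) (allowed : Fm → Prop) : Fm → Prop
  | ax {a b : Fm} : a ∈ L → AlphVar a b → CDProof L allowed b
  | cd {p q c : Fm} : CDProof L allowed p → CDProof L allowed q → CD p q c → allowed c →
      CDProof L allowed c

/-- `B` is provable from `L` by condensed detachment. -/
def CDProvable (L : Set Fm) (B : Fm) : Prop := CDProof L (fun _ => True) B

/-- A formula is double-negation free. -/
def DNFree (f : Fm) : Prop := ¬ ContainsDN f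

/-- `B` has a double-negation-free condensed-detachment proof from `L`
(no deduced step contains a double negation). -/
def DNFreeCDProvable (L : Set Fm) (B : Fm) : Prop := CDProof L DNFree B

/-- Every doubly negated subformula of `f` is (an alphabetic variant of) a doubly
negated subformula of `B`. -/
def DNOk (B : Fm) : Fm → Prop := fun f =>
  ∀ t : Fm, Fm.Sub (Fm.n (Fm.n t)) f → ∃ s : Fm, Fm.Sub (Fm.n (Fm.n s)) B ∧ AlphVar s t

/-- Existence of a proof from axioms `L` and (variable-free) assumptions `Δ` using
modus ponens and substitution, in which every deduced step satisfies `allowed`. -/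
inductive HProof (L Δ : Set Fm) (allowed : Fm → Prop) : Fm → Prop
  | ax {a : Fm} : a ∈ L → HProof L Δ allowed a
  | hyp {a : Fm} : a ∈ Δ → HProof L Δ allowed a
  | mp {a b : Fm} : HProof L Δ allowed (Fm.i a b) → HProof L Δ allowed a → allowed b →
      HProof L Δ allowed b
  | subst {a : Fm} (σ : ℕ → Fm) : HProof L Δ allowed a → allowed (a.subst σ) →
      HProof L Δ allowed (a.subst σ)

/-- Existence of a proof by modus ponens only from the set `S` of premisses, in which
every deduced step satisfies `allowed`. -/
inductive MPProof (S : Set Fm) (allowed : Fm → Prop) : Fm → Prop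
  | prem {a : Fm} : a ∈ S → MPProof S allowed a
  | mp {a b : Fm} : MPProof S allowed (Fm.i a b) → MPProof S allowed a → allowed b →
      MPProof S allowed b

/-- The set of substitution instances of members of `L`. -/
def SubstInstances (L : Set Fm) : Set Fm := {b | ∃ a ∈ L, ∃ σ : ℕ → Fm, b = a.subst σ}

/-- A formula containing no variables. -/
def VarFree (A : Fm) : Prop := A.vars = ∅

/-- Replace all occurrences of the selected doubly negated subformulas `n(n(q))`
(`q ∈ S`) by `q`. -/
def eraseDN (S : Finset Fm) : Fm → Fm
  | .var k => .var k
  | .i a b => .i (eraseDN S a) (eraseDN S b)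
  | .n (.var k) => .n (.var k)
  | .n (.i a b) => .n (.i (eraseDN S a) (eraseDN S b))
  | .n (.n q) => if q ∈ S then eraseDN S q else .n (eraseDN S (.n q))

/-- `L` admits strong double-negation elimination: whenever `B` is provable from `L`
by condensed detachment and `B*` is obtained from `B` by erasing all occurrences of
a chosen set of doubly negated subformulas of `B`, then `B*` has a condensed-detachment
proof from `L` whose deduced steps contain no doubly negated subformulas other than
(alphabetic variants of) those occurring in `B*`. -/
def StrongDNE (L : Set Fm) : Prop :=
  ∀ (B : Fm) (S : Finset Fm), CDProvable L B → (∀ q ∈ S, Fm.Sub (.n (.n q)) B) →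
    CDProof L (DNOk (eraseDN S B)) (eraseDN S B)

/-- Replace every occurrence of the variable `v` by `n(v)` and cancel the resulting
double negations. -/
def flipNeg (v : ℕ) : Fm → Fm
  | .var k => if k = v then .n (.var v) else .var k
  | .i a b => .i (flipNeg v a) (flipNeg v b)
  | .n a => if a = .var v then .var v else .n (flipNeg v a)

/-- Membership in `L*`: the closure of `L` under the operation of replacing a
negated variable `x` (i.e. one with `n(x)` occurring) everywhere by `n(x)`,
cancelling resulting double negations. -/
inductive StarMem (L : Set Fm) : Fm → Prop
  | base {a : Fm} : a ∈ L → StarMem L a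
  | step {a : Fm} {v : ℕ} : StarMem L a → Fm.Sub (.n (.var v)) a → StarMem L (flipNeg v a)

/-- D1 = i(x,x) -/
def D1 : Fm := .i (.var 0) (.var 0)
/-- D2 = i(i(x,x),i(n(x),n(x))) -/
def D2 : Fm := .i (.i (.var 0) (.var 0)) (.i (.n (.var 0)) (.n (.var 0)))
/-- D3 = i(i(x,x),i(i(y,y),i(i(x,y),i(x,y)))) -/
def D3 : Fm := .i (.i (.var 0) (.var 0))
  (.i (.i (.var 1) (.var 1)) (.i (.i (.var 0) (.var 1)) (.i (.var 0) (.var 1))))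

/-- L1 = i(i(x,y),i(i(y,z),i(x,z))) -/
def L1 : Fm := .i (.i (.var 0) (.var 1)) (.i (.i (.var 1) (.var 2)) (.i (.var 0) (.var 2)))
/-- L2 = i(i(n(x),x),x) -/
def L2 : Fm := .i (.i (.n (.var 0)) (.var 0)) (.var 0)
/-- L3 = i(x,i(n(x),y)) -/
def L3 : Fm := .i (.var 0) (.i (.n (.var 0)) (.var 1))
/-- L4 = i(i(x,n(x)),n(x)) -/
def L4 : Fm := .i (.i (.var 0) (.n (.var 0))) (.n (.var 0))
/-- L5 = i(n(x),i(x,y)) -/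
def L5 : Fm := .i (.n (.var 0)) (.i (.var 0) (.var 1))
/-- The Łukasiewicz axiom system for two-valued propositional calculus. -/
def Lax : Set Fm := {L1, L2, L3}

/-- A1 = i(x,i(y,x)) -/
def A1 : Fm := .i (.var 0) (.i (.var 1) (.var 0))
/-- A2 = i(i(x,y),i(i(y,z),i(x,z))) -/
def A2 : Fm := .i (.i (.var 0) (.var 1)) (.i (.i (.var 1) (.var 2)) (.i (.var 0) (.var 2)))
/-- A3 = i(i(i(x,y),y),i(i(y,x),x)) -/
def A3 : Fm := .i (.i (.i (.var 0) (.var 1)) (.var 1)) (.i (.i (.var 1) (.var 0)) (.var 0))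
/-- A4 = i(i(n(x),n(y)),i(y,x)) -/
def A4 : Fm := .i (.i (.n (.var 0)) (.n (.var 1))) (.i (.var 1) (.var 0))
/-- A6 = i(i(x,y),i(n(y),n(x))) -/
def A6 : Fm := .i (.i (.var 0) (.var 1)) (.i (.n (.var 1)) (.n (.var 0)))
/-- A7 = i(i(n(x),y),i(n(y),x)) -/
def A7 : Fm := .i (.i (.n (.var 0)) (.var 1)) (.i (.n (.var 1)) (.var 0))
/-- A8 = i(i(x,n(y)),i(y,n(x))) -/
def A8 : Fm := .i (.i (.var 0) (.n (.var 1))) (.i (.var 1) (.n (.var 0)))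
/-- The axiom system of Łukasiewicz's infinite-valued sentential calculus. -/
def Aax : Set Fm := {A1, A2, A3, A4}

/-- H1 = i(x,i(y,x)) -/
def H1 : Fm := .i (.var 0) (.i (.var 1) (.var 0))
/-- H2 = i(i(x,i(y,z)),i(i(x,y),i(x,z))) -/
def H2 : Fm := .i (.i (.var 0) (.i (.var 1) (.var 2)))
  (.i (.i (.var 0) (.var 1)) (.i (.var 0) (.var 2)))
/-- H3 = i(i(x,n(x)),n(x)) -/
def H3 : Fm := .i (.i (.var 0) (.n (.var 0))) (.n (.var 0))
/-- H4 = i(x,i(n(x),y)) -/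
def H4 : Fm := .i (.var 0) (.i (.n (.var 0)) (.var 1))
/-- The intuitionistic axiom system H. -/
def Hax : Set Fm := {H1, H2, H3, H4}

/-! ### Substitutions and variables -/

namespace Fm

theorem subst_subst (σ τ : ℕ → Fm) (f : Fm) :
    (f.subst σ).subst τ = f.subst fun k => (σ k).subst τ := by
  induction f <;> simp_all [subst]

theorem subst_congr {σ τ : ℕ → Fm} {f : Fm} (h : ∀ k ∈ f.vars, σ k = τ k) :
    f.subst σ = f.subst τ := by
  induction f <;> simp_all [subst, vars]

theorem subst_eq_self {σ : ℕ → Fm} {f : Fm} (h : ∀ k ∈ f.vars, σ k = var k) :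
    f.subst σ = f := by
  induction f <;> simp_all [subst, vars]

theorem mem_vars_subst {σ : ℕ → Fm} {f : Fm} {k : ℕ} :
    k ∈ (f.subst σ).vars ↔ ∃ j ∈ f.vars, k ∈ (σ j).vars := by
  induction f with
  | var m => simp [subst, vars]
  | i a b iha ihb => simp [subst, vars, iha, ihb, or_and_right, exists_or]
  | n a ih => simp [subst, vars, ih]

theorem eqOn_vars_of_subst_eq {σ τ : ℕ → Fm} {f : Fm} (h : f.subst σ = f.subst τ) :
    ∀ k ∈ f.vars, σ k = τ k := by
  induction f with
  | var m => simpa [subst, vars] using h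
  | i a b iha ihb =>
    simp only [subst, i.injEq] at h
    intro k hk
    rcases Finset.mem_union.1 hk with hk | hk
    exacts [iha h.1 k hk, ihb h.2 k hk]
  | n a ih => exact ih (by simpa [subst] using h)

/-- A strict upper bound for the variables of a formula. -/
def bound : Fm → ℕ
  | var k => k + 1
  | i a b => max (bound a) (bound b)
  | n a => bound a

theorem lt_bound {f : Fm} {k : ℕ} (h : k ∈ f.vars) : k < f.bound := by
  induction f with
  | var m => simp_all [vars, bound]
  | i a b iha ihb =>
    rcases Finset.mem_union.1 h with h | h
    exacts [lt_max_of_lt_left (iha h), lt_max_of_lt_right (ihb h)]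
  | n a ih => exact ih h

theorem sub_i_iff {s a b : Fm} : Sub s (i a b) ↔ s = i a b ∨ Sub s a ∨ Sub s b := by
  constructor
  · rintro (_ | h | h)
    exacts [.inl rfl, .inr (.inl h), .inr (.inr h)]
  · rintro (rfl | h | h)
    exacts [.refl _, .il h, .ir h]

theorem sub_n_iff {s a : Fm} : Sub s (n a) ↔ s = n a ∨ Sub s a := by
  constructor
  · rintro (_ | _ | _ | h)
    exacts [.inl rfl, .inr h]
  · rintro (rfl | h)
    exacts [.refl _, .neg h]

theorem sub_var_iff {s : Fm} {k : ℕ} : Sub s (var k) ↔ s = var k := by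
  constructor
  · rintro ⟨⟩
    rfl
  · rintro rfl
    exact .refl _

end Fm

open Fm

/-! ### Alphabetic variants -/

theorem AlphVar.refl (a : Fm) : AlphVar a a :=
  ⟨1, (subst_eq_self fun _ _ => rfl).symm⟩

theorem AlphVar.trans {a b c : Fm} : AlphVar a b → AlphVar b c → AlphVar a c := by
  rintro ⟨p, rfl⟩ ⟨q, rfl⟩
  exact ⟨q * p, by rw [subst_subst]; rfl⟩

theorem CD.alphVar {p q c d : Fm} (h : CD p q c) (hd : AlphVar c d) : CD p q d := by
  obtain ⟨A, B, C, σ, h1, h2, h3, h4, h5⟩ := h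
  exact ⟨A, B, C, σ, h1, h2, h3, h4, h5.trans hd⟩

theorem CDProof.mono {L : Set Fm} {P Q : Fm → Prop} (h : ∀ f, P f → Q f) {f : Fm}
    (hf : CDProof L P f) : CDProof L Q f := by
  induction hf with
  | ax ha hab => exact .ax ha hab
  | cd _ _ h3 h4 ih1 ih2 => exact .cd ih1 ih2 h3 (h _ h4)

/-- The involution exchanging the blocks `[0, N)` and `[N, 2N)`. -/
def blockSwap (N : ℕ) : Equiv.Perm ℕ :=
  Function.Involutive.toPerm
    (fun k => if k < N then k + N else if k < N + N then k - N else k) <| by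
      intro k
      dsimp only
      split_ifs <;> omega

theorem blockSwap_of_lt {N k : ℕ} (h : k < N) : blockSwap N k = k + N :=
  if_pos h

theorem blockSwap_add {N k : ℕ} (h : k < N) : blockSwap N (k + N) = k := by
  have h1 : ¬ k + N < N := by omega
  have h2 : k + N < N + N := by omega
  exact (if_neg h1).trans ((if_pos h2).trans (Nat.add_sub_cancel k N))

theorem le_of_mem_vars_blockSwap {N k : ℕ} {f : Fm} (hf : ∀ j ∈ f.vars, j < N)
    (hk : k ∈ (f.subst (renameSubst (blockSwap N))).vars) : N ≤ k := by
  obtain ⟨j, hj, hk⟩ := mem_vars_subst.1 hk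
  simp only [renameSubst, vars, Finset.mem_singleton] at hk
  rw [hk, blockSwap_of_lt (hf j hj)]
  omega

theorem subst_blockSwap_eq_self {N : ℕ} {f : Fm} {σ : ℕ → Fm} (hf : ∀ j ∈ f.vars, j < N)
    (hσ : ∀ j ∈ f.vars, σ (j + N) = var j) :
    (f.subst (renameSubst (blockSwap N))).subst σ = f := by
  rw [subst_subst]
  refine subst_eq_self fun k hk => ?_
  simp [renameSubst, subst, blockSwap_of_lt (hf k hk), hσ k hk]

/-! ### Two special cases of condensed detachment -/

/-- Condensed detachment when the antecedent of the major premiss is an instance of the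
minor premiss. -/
theorem CD.of_antecedent_instance (Q B : Fm) (ρ : ℕ → Fm) : CD (i (Q.subst ρ) B) Q B := by
  classical
  obtain ⟨N, hQ, hM⟩ : ∃ N, (∀ k ∈ Q.vars, k < N) ∧ ∀ k ∈ (i (Q.subst ρ) B).vars, k < N :=
    ⟨max Q.bound (i (Q.subst ρ) B).bound, fun k hk => lt_max_of_lt_left (lt_bound hk),
      fun k hk => lt_max_of_lt_right (lt_bound hk)⟩
  have hC : ∀ k ∈ (Q.subst (renameSubst (blockSwap N))).vars, N ≤ k := fun k hk =>
    le_of_mem_vars_blockSwap hQ hk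
  set C := Q.subst (renameSubst (blockSwap N)) with hCdef
  let σ : ℕ → Fm := fun k => if k ∈ C.vars then ρ (blockSwap N k) else var k
  have hσ : ∀ k < N, σ k = var k := fun k hk => if_neg fun h => by
    have := hC k h
    omega
  have hCσ : C.subst σ = Q.subst ρ := by
    rw [hCdef, subst_subst]
    refine subst_congr fun k hk => ?_
    have hmem : blockSwap N k ∈ C.vars :=
      mem_vars_subst.2 ⟨k, hk, by simp [renameSubst, vars]⟩
    have : blockSwap N (blockSwap N k) = k := by
      rw [blockSwap_of_lt (hQ k hk), blockSwap_add (hQ k hk)]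
    simp only [renameSubst, subst, σ, if_pos hmem, this]
  have hAσ : (Q.subst ρ).subst σ = Q.subst ρ :=
    subst_eq_self fun k hk => hσ k (hM k (Finset.mem_union_left _ hk))
  refine ⟨Q.subst ρ, B, C, σ, rfl, ⟨_, rfl⟩, ?_, ⟨hAσ.trans hCσ.symm, ?_⟩, ?_⟩
  · rw [Finset.disjoint_left]
    intro k hk hk'
    have := hM k hk
    have := hC k hk'
    omega
  · intro τ hτ
    refine ⟨τ, fun k => ?_⟩
    by_cases hk : k ∈ C.vars
    · have h1 : C.subst τ = C.subst fun k => (σ k).subst τ := by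
        rw [← subst_subst, hCσ]
        exact hτ.symm
      exact eqOn_vars_of_subst_eq h1 k hk
    · simp [σ, hk, subst]
  · have : B.subst σ = B :=
      subst_eq_self fun k hk => hσ k (hM k (Finset.mem_union_right _ hk))
    rw [this]
    exact AlphVar.refl B

theorem CD.modusPonens (a b : Fm) : CD (i a b) a b := by
  have h : a.subst var = a := subst_eq_self fun _ _ => rfl
  simpa only [h] using CD.of_antecedent_instance a b var

/-- Condensed detachment when the minor premiss is an instance of the antecedent of the major
premiss, whose consequent may contain one further variable `b`. -/
theorem CD.of_minor_instance {A B : Fm} {ρ : ℕ → Fm} (b c : ℕ)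
    (hB : ∀ k ∈ B.vars, k ∈ A.vars ∨ k = b ∧ ρ b = var c) (hc : c ∉ (A.subst ρ).vars) :
    CD (i A B) (A.subst ρ) (B.subst ρ) := by
  classical
  obtain ⟨N, hA, hM, hb, hcN⟩ : ∃ N, (∀ k ∈ (A.subst ρ).vars, k < N) ∧
      (∀ k ∈ (i A B).vars, k < N) ∧ b < N ∧ c < N :=
    ⟨max (max (A.subst ρ).bound (i A B).bound) (max (b + 1) (c + 1)),
      fun k hk => lt_max_of_lt_left (lt_max_of_lt_left (lt_bound hk)),
      fun k hk => lt_max_of_lt_left (lt_max_of_lt_right (lt_bound hk)), by omega, by omega⟩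
  have hC : ∀ k ∈ ((A.subst ρ).subst (renameSubst (blockSwap N))).vars, N ≤ k := fun k hk =>
    le_of_mem_vars_blockSwap hA hk
  set C := (A.subst ρ).subst (renameSubst (blockSwap N)) with hCdef
  let σ : ℕ → Fm := fun k =>
    if k ∈ A.vars then (ρ k).subst (renameSubst (blockSwap N)) else var k
  have hAσ : A.subst σ = C := by
    rw [hCdef, subst_subst]
    exact subst_congr fun k hk => if_pos hk
  have hCσ : C.subst σ = C := subst_eq_self fun k hk => if_neg fun h => by
    have := hM k (Finset.mem_union_left _ h)
    have := hC k hk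
    omega
  refine ⟨A, B, C, σ, rfl, ⟨_, rfl⟩, ?_, ⟨hAσ.trans hCσ.symm, ?_⟩, ?_⟩
  · rw [Finset.disjoint_left]
    intro k hk hk'
    have := hM k hk
    have := hC k hk'
    omega
  · intro τ hτ
    refine ⟨τ, fun k => ?_⟩
    by_cases hk : k ∈ A.vars
    · have h1 : A.subst τ = A.subst fun k => (σ k).subst τ := by
        rw [← subst_subst, hAσ]
        exact hτ
      exact eqOn_vars_of_subst_eq h1 k hk
    · simp [σ, hk, subst]
  · refine ⟨Equiv.swap (b + N) c * blockSwap N, ?_⟩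
    rw [subst_subst]
    refine subst_congr fun k hk => ?_
    by_cases hkA : k ∈ A.vars
    · simp only [σ, if_pos hkA]
      rw [subst_subst]
      refine (subst_eq_self fun j hj => ?_).symm
      have hj' : j ∈ (A.subst ρ).vars := mem_vars_subst.2 ⟨k, hkA, hj⟩
      have hjN := hA j hj'
      have hjc : j ≠ c := fun h => hc (h ▸ hj')
      simp only [renameSubst, subst, Equiv.Perm.mul_apply, blockSwap_of_lt hjN,
        blockSwap_add hjN]
      rw [Equiv.swap_apply_of_ne_of_ne (by omega) hjc]
    · obtain ⟨rfl, hρ⟩ := (hB k hk).resolve_left hkA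
      simp [σ, hkA, hρ, subst, renameSubst, blockSwap_of_lt hb]

/-! ### A verified condensed-detachment calculator -/

/-- The substitution replacing `x` by `t`. -/
def single (x : ℕ) (t : Fm) : ℕ → Fm := fun k => if k = x then t else var k

/-- Fuelled unification; on success, the most general unifier is applied to the last argument. -/
def unify : ℕ → List (Fm × Fm) → Fm → Option Fm
  | 0, _, _ => none
  | _ + 1, [], B => some B
  | m + 1, (.var x, t) :: r, B =>
    if t = .var x then unify m r B
    else if x ∈ t.vars then none
    else unify m (r.map fun e => (e.1.subst (single x t), e.2.subst (single x t)))
      (B.subst (single x t))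
  | m + 1, (s, .var x) :: r, B => unify m ((.var x, s) :: r) B
  | m + 1, (.i a b, .i c d) :: r, B => unify m ((a, c) :: (b, d) :: r) B
  | m + 1, (.n a, .n c) :: r, B => unify m ((a, c) :: r) B
  | _ + 1, _ :: _, _ => none

theorem unify_sound {m : ℕ} {es : List (Fm × Fm)} {B c : Fm} (h : unify m es B = some c) :
    ∃ δ : ℕ → Fm, (∀ e ∈ es, Unifies δ e.1 e.2) ∧
      (∀ τ : ℕ → Fm, (∀ e ∈ es, Unifies τ e.1 e.2) → ∀ k, τ k = (δ k).subst τ) ∧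
      c = B.subst δ := by
  fun_induction unify m es B with
  | case1 => simp at h
  | case2 m B =>
    obtain rfl : B = c := by simpa using h
    exact ⟨var, by simp, fun τ _ k => rfl, (subst_eq_self fun _ _ => rfl).symm⟩
  | case3 m x r B ih =>
    obtain ⟨δ, h1, h2, h3⟩ := ih h
    refine ⟨δ, ?_, fun τ hτ => h2 τ fun e he => hτ e (List.mem_cons_of_mem _ he), h3⟩
    simpa [Unifies] using h1
  | case4 => simp at h
  | case5 m x t r B hne hx ih =>
    obtain ⟨δ, h1, h2, h3⟩ := ih h
    refine ⟨fun k => (single x t k).subst δ, ?_, ?_, by rw [h3, subst_subst]⟩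
    · intro e he
      rcases List.mem_cons.1 he with rfl | he
      · simp only [Unifies, ← subst_subst]
        congr 1
        rw [subst_eq_self (f := t) (σ := single x t) fun k hk =>
          if_neg (ne_of_mem_of_not_mem hk hx)]
        simp [subst, single]
      · have := h1 _ (List.mem_map_of_mem he)
        simpa only [Unifies, subst_subst] using this
    · intro τ hτ
      have hs : ∀ k, (single x t k).subst τ = τ k := by
        intro k
        by_cases hk : k = x
        · subst hk
          have h4 : Unifies τ (var k) t := hτ _ List.mem_cons_self
          simpa [single, Unifies, subst] using h4.symm
        · simp [single, hk, subst]
      have hδ := h2 τ fun e he => by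
        obtain ⟨e', he', rfl⟩ := List.mem_map.1 he
        have := hτ e' (List.mem_cons_of_mem _ he')
        simpa only [Unifies, subst_subst, hs] using this
      intro k
      rw [subst_subst]
      simp only [← hδ, hs]
  | case6 m s x r B hs ih =>
    obtain ⟨δ, h1, h2, h3⟩ := ih h
    refine ⟨δ, ?_, fun τ hτ => h2 τ ?_, h3⟩
    · simpa [Unifies, eq_comm] using h1
    · simpa [Unifies, eq_comm] using hτ
  | case7 m a b c d r B ih =>
    obtain ⟨δ, h1, h2, h3⟩ := ih h
    refine ⟨δ, ?_, fun τ hτ => h2 τ ?_, h3⟩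
    · simpa [Unifies, subst, and_assoc] using h1
    · simpa [Unifies, subst, and_assoc] using hτ
  | case8 m a c r B ih =>
    obtain ⟨δ, h1, h2, h3⟩ := ih h
    refine ⟨δ, ?_, fun τ hτ => h2 τ ?_, h3⟩
    · simpa [Unifies, subst] using h1
    · simpa [Unifies, subst] using hτ
  | case9 => simp at h

/-- The variables of a formula in order of occurrence. -/
def varList : Fm → List ℕ
  | .var k => [k]
  | .i a b => varList a ++ varList b
  | .n a => varList a

/-- Renumber the variables not below `j`, in order of first occurrence. -/
def renumber : ℕ → ℕ → Fm → Fm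
  | 0, _, f => f
  | m + 1, j, f =>
    match (varList f).find? (fun k => j ≤ k) with
    | none => f
    | some v => renumber m (j + 1) (f.subst (renameSubst (Equiv.swap j v)))

theorem alphVar_renumber (m j : ℕ) (f : Fm) : AlphVar f (renumber m j f) := by
  fun_induction renumber m j f with
  | case1 => exact .refl _
  | case2 => exact .refl _
  | case3 m j f v _ ih => exact AlphVar.trans ⟨_, rfl⟩ ih

/-- Absence of double negations, as a Boolean test. -/
def isDNFree : Fm → Bool
  | .var _ => true
  | .i a b => isDNFree a && isDNFree b
  | .n (.n _) => false
  | .n a => isDNFree a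

theorem dnFree_of_isDNFree {f : Fm} (h : isDNFree f = true) : DNFree f := by
  rintro ⟨t, ht⟩
  fun_induction isDNFree f with
  | case1 => simp [sub_var_iff] at ht
  | case2 a b iha ihb =>
    simp only [Bool.and_eq_true] at h
    simp only [sub_i_iff, reduceCtorEq, false_or] at ht
    exact ht.elim (iha h.1) (ihb h.2)
  | case3 => simp at h
  | case4 a ha ih =>
    rcases sub_n_iff.1 ht with ht | ht
    · exact ha t (Fm.n.inj ht).symm
    · exact ih h ht

/-- The normalized result of condensed detachment, computed with bounded fuel and required to be
free of double negations. -/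
def detach : Fm → Fm → Option Fm
  | .i A B, q =>
    let N := max (i A B).bound q.bound
    match unify 200 [(A, q.subst (renameSubst (blockSwap N)))] B with
    | none => none
    | some c => if isDNFree (renumber 20 0 c) then some (renumber 20 0 c) else none
  | _, _ => none

theorem detach_sound {p q c : Fm} (h : detach p q = some c) : CD p q c ∧ DNFree c := by
  unfold detach at h
  split at h
  · next A B =>
    dsimp only at h
    split at h
    · simp at h
    · next c' hc' =>
      split at h
      · next hfree =>
        obtain rfl : renumber 20 0 c' = c := by simpa using h
        refine ⟨?_, dnFree_of_isDNFree hfree⟩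
        obtain ⟨δ, h1, h2, rfl⟩ := unify_sound hc'
        refine ⟨A, B, _, δ, rfl, ⟨_, rfl⟩, ?_, ⟨h1 _ List.mem_cons_self, fun τ hτ => ?_⟩,
          alphVar_renumber _ _ _⟩
        · rw [Finset.disjoint_left]
          intro k hk hk'
          have h3 := lt_bound hk
          have h4 := le_of_mem_vars_blockSwap
            (fun j hj => lt_max_of_lt_right (lt_bound hj)) hk'
          exact absurd (lt_max_of_lt_left h3) (not_lt.2 h4)
        · exact ⟨τ, h2 τ fun e he => by rwa [List.mem_singleton.1 he]⟩
      · simp at h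
  · simp at h

/-- Formulas with a double-negation-free condensed-detachment proof. -/
abbrev DNFreeThm : Type := {f : Fm // DNFreeCDProvable Lax f}

/-- Trees of condensed detachments applied to known theorems. -/
inductive DTree : Type
  | thm : DNFreeThm → DTree
  | app : DTree → DTree → DTree

namespace DTree

/-- The formula proved by a tree of condensed detachments. -/
def concl : DTree → Option Fm
  | thm f => some f.1
  | app s t =>
    match s.concl, t.concl with
    | some p, some q => detach p q
    | _, _ => none

theorem provable {t : DTree} {f : Fm} (h : t.concl = some f) : DNFreeCDProvable Lax f := by
  induction t generalizing f with
  | thm g =>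
    obtain rfl : g.1 = f := by simpa [concl] using h
    exact g.2
  | app s t ihs iht =>
    simp only [concl] at h
    split at h
    · next p q hp hq =>
      obtain ⟨h1, h2⟩ := detach_sound h
      exact .cd (ihs hp) (iht hq) h1 h2
    · simp at h

end DTree

namespace Luk

instance : Coe DNFreeThm DTree := ⟨DTree.thm⟩

instance : CoeFun DNFreeThm fun _ => DTree → DTree := ⟨fun f => DTree.app (DTree.thm f)⟩

instance : CoeFun DTree fun _ => DTree → DTree := ⟨DTree.app⟩

/-- The axiom `L1` as a theorem. -/
def l1 : DNFreeThm := ⟨L1, .ax (by simp [Lax]) (.refl _)⟩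

/-- The axiom `L2` as a theorem. -/
def l2 : DNFreeThm := ⟨L2, .ax (by simp [Lax]) (.refl _)⟩

/-- The axiom `L3` as a theorem. -/
def l3 : DNFreeThm := ⟨L3, .ax (by simp [Lax]) (.refl _)⟩

/-- `CCCCpqCrqsCCrps` in Polish notation. -/
def auxCCCCpqCrqsCCrps : DNFreeThm where
  val := .i (.i (.i (.i (.var 0) (.var 1)) (.i (.var 2) (.var 1))) (.var 3)) (.i (.i (.var 2)
    (.var 0)) (.var 3))
  property := DTree.provable
    (t := l1 l1)
    (by decide +kernel)

/-- `CCCNpqrCpr` in Polish notation. -/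
def auxCCCNpqrCpr : DNFreeThm where
  val := .i (.i (.i (.n (.var 0)) (.var 1)) (.var 2)) (.i (.var 0) (.var 2))
  property := DTree.provable
    (t := l1 l3)
    (by decide +kernel)

/-- `i(x,x)` -/
def combI : DNFreeThm where
  val := .i (.var 0) (.var 0)
  property := DTree.provable
    (t := auxCCCNpqrCpr l2)
    (by decide +kernel)

/-- `CCpCNqqCrCpq` in Polish notation. -/
def auxCCpCNqqCrCpq : DNFreeThm where
  val := .i (.i (.var 0) (.i (.n (.var 1)) (.var 1))) (.i (.var 2) (.i (.var 0) (.var 1)))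
  property := DTree.provable
    (t := auxCCCCpqCrqsCCrps (l1 (l1 (l1 (auxCCCNpqrCpr (l1 (l3 combI))) l2) (l1
      l2))))
    (by decide +kernel)

/-- `i(x,i(y,x))` -/
def combK : DNFreeThm where
  val := .i (.var 0) (.i (.var 1) (.var 0))
  property := DTree.provable
    (t := auxCCpCNqqCrCpq (l1 (l1 (auxCCCNpqrCpr l1) auxCCCNpqrCpr) auxCCpCNqqCrCpq)
      l2)
    (by decide +kernel)

/-- `CpCCpqq` in Polish notation. -/
def auxCpCCpqq : DNFreeThm where
  val := .i (.var 0) (.i (.i (.var 0) (.var 1)) (.var 1))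
  property := DTree.provable
    (t := auxCCpCNqqCrCpq (l1 combK (auxCCCCpqCrqsCCrps auxCCpCNqqCrCpq)) l2)
    (by decide +kernel)

/-- `CCCCpqqrCpr` in Polish notation. -/
def auxCCCCpqqrCpr : DNFreeThm where
  val := .i (.i (.i (.i (.var 0) (.var 1)) (.var 1)) (.var 2)) (.i (.var 0) (.var 2))
  property := DTree.provable
    (t := l1 auxCpCCpqq)
    (by decide +kernel)

/-- `i(i(x,y),i(i(z,x),i(z,y)))` -/
def combB : DNFreeThm where
  val := .i (.i (.var 0) (.var 1)) (.i (.i (.var 2) (.var 0)) (.i (.var 2) (.var 1)))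
  property := DTree.provable
    (t := auxCCCCpqqrCpr auxCCCCpqCrqsCCrps)
    (by decide +kernel)

/-- `i(i(x,i(y,z)),i(y,i(x,z)))` -/
def combC : DNFreeThm where
  val := .i (.i (.var 0) (.i (.var 1) (.var 2))) (.i (.var 1) (.i (.var 0) (.var 2)))
  property := DTree.provable
    (t := auxCCCCpqCrqsCCrps auxCCCCpqqrCpr)
    (by decide +kernel)

/-- `i(i(x,i(x,y)),i(x,y))` -/
def combW : DNFreeThm where
  val := .i (.i (.var 0) (.i (.var 0) (.var 1))) (.i (.var 0) (.var 1))
  property := DTree.provable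
    (t := auxCCCCpqCrqsCCrps (auxCCCCpqCrqsCCrps (auxCCCCpqCrqsCCrps (auxCpCCpqq l2))
      (auxCCCCpqqrCpr auxCCCNpqrCpr)))
    (by decide +kernel)

/-- `i(i(x,i(y,z)),i(i(x,y),i(x,z)))` -/
def combS : DNFreeThm where
  val := .i (.i (.var 0) (.i (.var 1) (.var 2))) (.i (.i (.var 0) (.var 1)) (.i (.var 0) (.var 2)))
  property := DTree.provable
    (t := combB (combB combW) (combB combC (combB combB)))
    (by decide +kernel)

/-- The formula `L4`. -/
def l4 : DNFreeThm where
  val := .i (.i (.var 0) (.n (.var 0))) (.n (.var 0))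
  property := DTree.provable
    (t := l2 (combB (combC combI) (combB l2 (combC (combB l3 combK)))))
    (by decide +kernel)

/-- The formula `L5`. -/
def l5 : DNFreeThm where
  val := .i (.n (.var 0)) (.i (.var 0) (.var 1))
  property := DTree.provable
    (t := combC l3)
    (by decide +kernel)

/-- `i(i(x,y),i(n(y),n(x)))` -/
def contrapose : DNFreeThm where
  val := .i (.i (.var 0) (.var 1)) (.i (.n (.var 1)) (.n (.var 0)))
  property := DTree.provable
    (t := l2 (combB (combB l3) (combB (combC combI) (combB l2 (combC (combB l3
      (combB combK combK)))))))
    (by decide +kernel)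

/-- From `i(x,x)` and `i(y,y)` to `i(i(x,y),i(x,y))`, under a hypothesis. -/
def identImp : DNFreeThm where
  val := .i (.i (.var 0) (.i (.var 1) (.var 1))) (.i (.i (.var 0) (.i (.var 2) (.var 2))) (.i
    (.var 0) (.i (.i (.var 1) (.var 2)) (.i (.var 1) (.var 2)))))
  property := DTree.provable
    (t := combB (combS (combB combS (combB (combB combB) (combB combB)))) (combB
      (combC (combB combS (combB (combB combB) (combB combB)))) (combB (combB
      (combC combB)) (combS (combB combS (combB combB)) combI))))
    (by decide +kernel)

/-- From `i(x,x)` to `i(n(x),n(x))`, under a hypothesis. -/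
def identNeg : DNFreeThm where
  val := .i (.i (.var 0) (.i (.var 1) (.var 1))) (.i (.var 0) (.i (.n (.var 1)) (.n (.var 1))))
  property := DTree.provable
    (t := combB (combB contrapose) (combS (combB combS (combB combB)) combI))
    (by decide +kernel)

/-- From `i(y,y)` to `i(i(x,y),i(x,y))`. -/
def identCons : DNFreeThm where
  val := .i (.i (.var 0) (.var 0)) (.i (.i (.var 1) (.var 0)) (.i (.var 1) (.var 0)))
  property := DTree.provable
    (t := combS (combB combB combB) combB)
    (by decide +kernel)

/-- From `i(y,y)` to `i(i(i(x,y),i(x,y)),i(x,x))`. -/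
def identHead : DNFreeThm where
  val := .i (.i (.var 0) (.var 0)) (.i (.i (.i (.var 1) (.var 0)) (.i (.var 1) (.var 0))) (.i
    (.var 1) (.var 1)))
  property := DTree.provable
    (t := combB (combB (combS combK)) (combS (combB combB (combB combB combB))
      (combC (combB combB (combB combB combB)) (combB combC (combS combB
      combI)))))
    (by decide +kernel)

/-- From `i(i(y,y),z)` to `i(i(i(x,y),i(x,y)),z)`. -/
def identTail : DNFreeThm where
  val := .i (.i (.i (.var 0) (.var 0)) (.var 1)) (.i (.i (.i (.var 2) (.var 0)) (.i (.var 2)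
    (.var 0))) (.var 1))
  property := DTree.provable
    (t := combC combB (combB (combS combK) (combS combB (combC combB combK))))
    (by decide +kernel)

/-- `i(i(x,x),i(x,x))` -/
def identSelf : DNFreeThm where
  val := .i (.i (.var 0) (.var 0)) (.i (.var 0) (.var 0))
  property := DTree.provable
    (t := combS combB combI)
    (by decide +kernel)

end Luk

/-! ### Exact instances of double-negation-free theorems -/

/-- Every doubly negated subformula of `f` belongs to `D`. -/
def DNWithin (D : Set Fm) (f : Fm) : Prop := ∀ t : Fm, Sub (.n (.n t)) f → .n (.n t) ∈ D

section DNWithin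

variable {D : Set Fm}

theorem DNFree.dnWithin {f : Fm} (h : DNFree f) : DNWithin D f := fun t ht => (h ⟨t, ht⟩).elim

@[simp]
theorem dnWithin_var (k : ℕ) : DNWithin D (.var k) := by
  intro t ht
  simp [sub_var_iff] at ht

@[simp]
theorem dnWithin_i {a b : Fm} : DNWithin D (.i a b) ↔ DNWithin D a ∧ DNWithin D b := by
  simp [DNWithin, sub_i_iff, or_imp, forall_and]

@[simp]
theorem dnWithin_n {a : Fm} :
    DNWithin D (.n a) ↔ (∀ b, a = .n b → .n (.n b) ∈ D) ∧ DNWithin D a := by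
  simp [DNWithin, sub_n_iff, or_imp, forall_and, eq_comm]

theorem CDProof.modusPonens {a b : Fm} (hab : CDProof Lax (DNWithin D) (.i a b))
    (ha : CDProof Lax (DNWithin D) a) (hb : DNWithin D b) : CDProof Lax (DNWithin D) b :=
  .cd hab ha (CD.modusPonens a b) hb

theorem DNFreeThm.proof (f : DNFreeThm) : CDProof Lax (DNWithin D) f.1 :=
  CDProof.mono (fun _ => DNFree.dnWithin) f.2

/-- A formula `i(x_k, … i(x_1, x_0))` in which each of `x_0, …, x_k` occurs once. -/
def chain : ℕ → Fm
  | 0 => .var 0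
  | k + 1 => .i (.var (k + 1)) (chain k)

/-- A provable formula linking the variables `x_0, …, x_k`. -/
def link (k : ℕ) : Fm := .i (chain k) (chain k)

theorem vars_chain (k : ℕ) : (chain k).vars = Finset.range (k + 1) := by
  induction k with
  | zero => rfl
  | succ k ih => rw [chain, vars, vars, ih, Finset.range_add_one (n := k + 1)]; rfl

@[simp]
theorem dnWithin_chain (k : ℕ) : DNWithin D (chain k) := by
  induction k <;> simp_all [chain]

theorem provable_link (k : ℕ) : CDProof Lax (DNWithin D) (link k) := by
  induction k with
  | zero => exact Luk.combI.proof
  | succ k ih =>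
    refine .cd Luk.identCons.proof ih (CD.of_minor_instance
      (ρ := fun j => if j = 0 then chain k else .var (k + 1)) 1 (k + 1) ?_ ?_) ?_
    · simp [vars]
    · simp [subst, vars, vars_chain]
    · simp [link, chain]

theorem provable_link_var {j k : ℕ} (h : j ≤ k) :
    CDProof Lax (DNWithin D) (.i (link k) (.i (.var j) (.var j))) := by
  induction k with
  | zero =>
    obtain rfl : j = 0 := by omega
    exact Luk.identSelf.proof
  | succ k ih =>
    rcases h.eq_or_lt with rfl | h
    · refine .cd Luk.identHead.proof (provable_link k) (CD.of_minor_instance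
        (ρ := fun j => if j = 0 then chain k else .var (k + 1)) 1 (k + 1) ?_ ?_) ?_
      · simp [vars]
      · simp [subst, vars, vars_chain]
      · simp [link, chain]
    · refine .cd Luk.identTail.proof (ih (Nat.lt_succ_iff.1 h)) (CD.of_minor_instance
        (ρ := fun m => if m = 0 then chain k else
          if m = 1 then .i (.var j) (.var j) else .var (k + 1)) 2 (k + 1) ?_ ?_) ?_
      · simp [vars]
      · simp [subst, vars, vars_chain]
        omega
      · simp [link, chain]

theorem provable_link_ident {k : ℕ} {a : Fm} (ha : DNWithin D a) (hk : ∀ j ∈ a.vars, j ≤ k) :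
    CDProof Lax (DNWithin D) (.i (link k) (.i a a)) := by
  induction a with
  | var m => exact provable_link_var (hk m (by simp [vars]))
  | n a ih =>
    refine .cd Luk.identNeg.proof (ih (dnWithin_n.1 ha).2 hk) (CD.of_minor_instance
      (ρ := fun j => if j = 0 then link k else a) 0 (k + 1) ?_ ?_) ?_
    · simp [vars]
    · have hna : k + 1 ∉ a.vars := fun h => absurd (hk _ h) (by omega)
      simp [subst, link, vars, vars_chain, hna]
    · simpa [subst, link] using ha
  | i a b iha ihb =>
    obtain ⟨ha, hb⟩ := dnWithin_i.1 ha
    have hka : ∀ j ∈ a.vars, j ≤ k := fun j hj => hk j (Finset.mem_union_left _ hj)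
    have hkb : ∀ j ∈ b.vars, j ≤ k := fun j hj => hk j (Finset.mem_union_right _ hj)
    have hna : k + 1 ∉ a.vars := fun h => absurd (hka _ h) (by omega)
    have hnb : k + 1 ∉ b.vars := fun h => absurd (hkb _ h) (by omega)
    let y : Fm := .var (k + 1)
    have h1 : CDProof Lax (DNWithin D) (.i (.i (link k) (.i y y))
        (.i (link k) (.i (.i a y) (.i a y)))) := by
      refine .cd Luk.identImp.proof (iha ha hka) (CD.of_minor_instance
        (ρ := fun j => if j = 0 then link k else if j = 1 then a else y) 2 (k + 1) ?_ ?_) ?_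
      · simp [vars, y]
      · simp [subst, link, vars, vars_chain, hna]
      · simp [link, y, ha]
    let ρ : ℕ → Fm := fun j => if j = k + 1 then b else .var j
    have hlink : (link k).subst ρ = link k := subst_eq_self fun j hj => by
      simp only [link, vars, vars_chain, Finset.union_self, Finset.mem_range] at hj
      exact if_neg (by omega)
    have haρ : a.subst ρ = a := subst_eq_self fun j hj => if_neg (by have := hka j hj; omega)
    have hyρ : y.subst ρ = b := by simp [y, ρ, subst]
    have h2 : CD (.i (.i (link k) (.i y y)) (.i (link k) (.i (.i a y) (.i a y))))
        (.i (link k) (.i b b)) (.i (link k) (.i (.i a b) (.i a b))) := by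
      have := CD.of_minor_instance (A := .i (link k) (.i y y))
        (B := .i (link k) (.i (.i a y) (.i a y))) (ρ := ρ) 0 (k + 1) ?_ ?_
      · simpa only [subst, hlink, haρ, hyρ] using this
      · intro j hj
        left
        simp only [link, y, vars, vars_chain, Finset.mem_union, Finset.mem_range,
          Finset.mem_singleton] at hj ⊢
        grind
      · simp only [subst, hlink, hyρ]
        simp [link, vars, vars_chain, hnb]
    exact .cd h1 (ihb hb hkb) h2 (by simp [link, ha, hb])

theorem provable_ident {a : Fm} (ha : DNWithin D a) : CDProof Lax (DNWithin D) (.i a a) :=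
  (provable_link_ident ha fun _ hj => (lt_bound hj).le).modusPonens (provable_link a.bound)
    (dnWithin_i.2 ⟨ha, ha⟩)

/-- Every instance of a double-negation-free theorem is provable using only the double
negations of that instance. -/
theorem DNFreeThm.instance_proof (f : DNFreeThm) (σ : ℕ → Fm) (h : DNWithin D (f.1.subst σ)) :
    CDProof Lax (DNWithin D) (f.1.subst σ) :=
  .cd (provable_ident h) f.proof (CD.of_antecedent_instance f.1 _ σ) h

/-! ### Cancelling double negations in modus ponens proofs -/

open Classical in
/-- Negation, cancelled against a leading negation unless the result lies in `D`. -/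
noncomputable def negCancel (D : Set Fm) : Fm → Fm
  | .n b => if .n (.n b) ∈ D then .n (.n b) else b
  | a => .n a

/-- Cancel, from the inside out, all double negations outside `D`. -/
noncomputable def cancelDN (D : Set Fm) : Fm → Fm
  | .var k => .var k
  | .i a b => .i (cancelDN D a) (cancelDN D b)
  | .n a => negCancel D (cancelDN D a)

theorem negCancel_cases (D : Set Fm) (a : Fm) :
    negCancel D a = .n a ∧ (∀ b, a = .n b → .n (.n b) ∈ D) ∨ a = .n (negCancel D a) := by
  cases a with
  | var k => simp [negCancel]
  | i a b => simp [negCancel]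
  | n b => by_cases h : Fm.n (.n b) ∈ D <;> simp [negCancel, h]

theorem dnWithin_cancelDN (f : Fm) : DNWithin D (cancelDN D f) := by
  induction f with
  | var k => exact dnWithin_var k
  | i a b iha ihb => exact dnWithin_i.2 ⟨iha, ihb⟩
  | n a ih =>
    rw [cancelDN]
    rcases negCancel_cases D (cancelDN D a) with ⟨h1, h2⟩ | h
    · rw [h1]
      exact dnWithin_n.2 ⟨h2, ih⟩
    · rw [h] at ih
      exact (dnWithin_n.1 ih).2

theorem cancelDN_eq_self {f : Fm} (h : DNWithin D f) : cancelDN D f = f := by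
  induction f with
  | var k => rfl
  | i a b iha ihb => rw [cancelDN, iha (dnWithin_i.1 h).1, ihb (dnWithin_i.1 h).2]
  | n a ih =>
    obtain ⟨h1, h2⟩ := dnWithin_n.1 h
    rw [cancelDN, ih h2]
    rcases negCancel_cases D a with ⟨h3, -⟩ | h3
    · exact h3
    · rw [h3, negCancel, if_pos (h1 _ h3)]

theorem provable_cancelDN {f : Fm} (hf : MPProof (SubstInstances Lax) (fun _ => True) f) :
    CDProof Lax (DNWithin D) (cancelDN D f) := by
  induction hf with
  | mp _ _ _ ih1 ih2 => exact ih1.modusPonens ih2 (dnWithin_cancelDN _)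
  | prem ha =>
    obtain ⟨a, ha, σ, rfl⟩ := ha
    have key : ∃ (g : DNFreeThm) (τ : ℕ → Fm), cancelDN D (a.subst σ) = g.1.subst τ := by
      obtain rfl | rfl | rfl : a = L1 ∨ a = L2 ∨ a = L3 := by simpa [Lax] using ha
      · exact ⟨Luk.l1, fun k => cancelDN D (σ k), rfl⟩
      · rcases negCancel_cases D (cancelDN D (σ 0)) with ⟨h, -⟩ | h
        · exact ⟨Luk.l2, fun k => cancelDN D (σ k), by simp [Luk.l2, L2, subst, cancelDN, h]⟩
        · refine ⟨Luk.l4, fun _ => negCancel D (cancelDN D (σ 0)), ?_⟩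
          simp only [Luk.l4, L2, subst, cancelDN, ← h]
      · rcases negCancel_cases D (cancelDN D (σ 0)) with ⟨h, -⟩ | h
        · exact ⟨Luk.l3, fun k => cancelDN D (σ k), by simp [Luk.l3, L3, subst, cancelDN, h]⟩
        · refine ⟨Luk.l5, fun k =>
            if k = 0 then negCancel D (cancelDN D (σ 0)) else cancelDN D (σ 1), ?_⟩
          simp [Luk.l5, L3, subst, cancelDN, ← h]
    obtain ⟨g, τ, h⟩ := key
    have hfree := dnWithin_cancelDN (D := D) (a.subst σ)
    rw [h] at hfree ⊢
    exact g.instance_proof τ hfree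

end DNWithin

/-! ### Erasing double negations preserves provability -/

/-- Provability by modus ponens from instances of the axioms. -/
abbrev LukProvable (f : Fm) : Prop := MPProof (SubstInstances Lax) (fun _ => True) f

theorem CDProof.lukProvable {P : Fm → Prop} {f : Fm} (hf : CDProof Lax P f) (σ : ℕ → Fm) :
    LukProvable (f.subst σ) := by
  induction hf generalizing σ with
  | ax ha hab =>
    obtain ⟨p, rfl⟩ := hab
    exact .prem ⟨_, ha, _, subst_subst _ _ _⟩
  | cd _ _ hcd _ ih1 ih2 =>
    obtain ⟨A, B, C, δ, rfl, ⟨p, rfl⟩, -, ⟨hδ, -⟩, ⟨q, rfl⟩⟩ := hcd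
    rw [subst_subst, subst_subst]
    have h1 := ih1 fun k => ((δ k).subst (renameSubst q)).subst σ
    have h2 := ih2 fun k => (renameSubst p k).subst fun k =>
      ((δ k).subst (renameSubst q)).subst σ
    have h3 := congrArg (fun f => (f.subst (renameSubst q)).subst σ) hδ
    simp only [subst_subst] at h1 h2 h3 ⊢
    refine .mp h1 ?_ trivial
    rwa [h3]

namespace LukProvable

theorem mp {a b : Fm} (hab : LukProvable (.i a b)) (ha : LukProvable a) : LukProvable b :=
  MPProof.mp hab ha trivial

theorem of_thm (f : DNFreeThm) (σ : ℕ → Fm) : LukProvable (f.1.subst σ) :=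
  CDProof.lukProvable f.2 σ

theorem ident (a : Fm) : LukProvable (.i a a) := of_thm Luk.combI fun _ => a

theorem trans {a b c : Fm} (hab : LukProvable (.i a b)) (hbc : LukProvable (.i b c)) :
    LukProvable (.i a c) :=
  ((of_thm Luk.l1 fun k => if k = 0 then a else if k = 1 then b else c).mp hab).mp hbc

theorem i_congr {a a' b b' : Fm} (ha : LukProvable (.i a' a)) (hb : LukProvable (.i b b')) :
    LukProvable (.i (.i a b) (.i a' b')) :=
  trans ((of_thm Luk.l1 fun k => if k = 0 then a' else if k = 1 then a else b).mp ha)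
    ((of_thm Luk.combB fun k => if k = 0 then b else if k = 1 then b' else a').mp hb)

theorem n_congr {a b : Fm} (h : LukProvable (.i a b)) : LukProvable (.i (.n b) (.n a)) :=
  (of_thm Luk.contrapose fun k => if k = 0 then a else b).mp h

theorem dn_elim (a : Fm) : LukProvable (.i (.n (.n a)) a) :=
  trans (of_thm Luk.l5 fun k => if k = 0 then .n a else a) (of_thm Luk.l2 fun _ => a)

theorem dn_intro (a : Fm) : LukProvable (.i a (.n (.n a))) :=
  trans (of_thm Luk.l3 fun k => if k = 0 then a else .n (.n a)) (of_thm Luk.l4 fun _ => .n a)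

theorem eraseDN_equiv (S : Finset Fm) (f : Fm) :
    LukProvable (.i f (eraseDN S f)) ∧ LukProvable (.i (eraseDN S f) f) := by
  fun_induction eraseDN S f with
  | case1 k => exact ⟨ident _, ident _⟩
  | case2 a b iha ihb => exact ⟨i_congr iha.2 ihb.1, i_congr iha.1 ihb.2⟩
  | case3 k => exact ⟨ident _, ident _⟩
  | case4 a b iha ihb =>
    exact ⟨n_congr (i_congr iha.1 ihb.2), n_congr (i_congr iha.2 ihb.1)⟩
  | case5 q _ ih => exact ⟨trans (dn_elim q) ih.1, trans ih.2 (dn_intro q)⟩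
  | case6 q _ ih => exact ⟨n_congr ih.2, n_congr ih.1⟩

end LukProvable

/-- The Łukasiewicz axiom system L1, L2, L3, with condensed detachment as the sole
rule of inference, admits strong double-negation elimination. -/
theorem stmt10 : StrongDNE Lax := by
  intro B S hB _
  have h1 : LukProvable B := by
    simpa only [subst_eq_self (f := B) (σ := Fm.var) fun _ _ => rfl] using hB.lukProvable Fm.var
  have h2 : LukProvable (eraseDN S B) := (LukProvable.eraseDN_equiv S B).1.mp h1
  let D : Set Fm := {f | Sub f (eraseDN S B)}
  have h3 := provable_cancelDN (D := D) h2
  rw [cancelDN_eq_self fun t ht => ht] at h3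
  exact h3.mono fun f hf t ht => ⟨t, hf t ht, .refl t⟩
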